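/- The map λ ↦ ε_λ from Δ([0,1]) (with the weak-* topology) to Δ({0,1}^ℕ) (with the weak-* topology) is a homeomorphism onto the set Γ of exchangeable probability measures on {0,1}^ℕ, and its inverse is the map μ ↦ μ̄, where μ̄ ∈ Δ([0,1]) is the pushforward of μ under the limit-average map L. -/

import Mathlib

open MeasureTheory Filter

/-- The realization space Ω = {0,1}^ℕ. -/
abbrev Omega : Type := ℕ → Bool

/-- The cylinder set N(σ) of realizations extending the partial realization σ. -/
def cyl (σ : List Bool) : Set Omega := {x | ∀ i : Fin σ.length, x i.1 = σ.get i}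

/-- μ is exchangeable: cylinder probabilities are invariant under permutations. -/
def Exchangeable (μ : Measure Omega) : Prop :=
  ∀ (σ : List Bool) (π : Equiv.Perm (Fin σ.length)),
    μ (cyl σ) = μ (cyl (List.ofFn (fun i => σ.get (π i))))

/-- ∏_{i<n} q^{s_i} (1-q)^{1-s_i} for the partial realization σ. -/
noncomputable def bern (σ : List Bool) (q : unitInterval) : ℝ :=
  ∏ i : Fin σ.length, (if σ.get i then (q : ℝ) else 1 - (q : ℝ))

/-- The limit-average map L(s₀,s₁,…) = limsup (s₀+⋯+s_{n-1})/n, valued in [0,1]. -/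
noncomputable def Lmap (x : Omega) : unitInterval :=
  Set.projIcc (0 : ℝ) 1 zero_le_one
    (Filter.limsup
      (fun n : ℕ => (∑ i ∈ Finset.range n, (if x i then (1 : ℝ) else 0)) / n) atTop)

open scoped Topology

theorem cyl_ofFn {m : ℕ} (s : Fin m → Bool) :
    cyl (List.ofFn s) = {x | ∀ i : Fin m, x i = s i} := by
  ext x
  simp only [cyl, Set.mem_ofPred_eq]
  constructor
  · intro h i
    simpa using h (Fin.cast (by simp) i)
  · intro h i
    rw [List.get_ofFn]
    exact h (Fin.cast (by simp) i)

theorem bern_ofFn {m : ℕ} (s : Fin m → Bool) (q : unitInterval) :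
    bern (List.ofFn s) q = ∏ i, (if s i then (q : ℝ) else 1 - (q : ℝ)) := by
  rw [bern]
  refine Fintype.prod_equiv (finCongr (by simp)) _ _ fun i => ?_
  rw [List.get_ofFn]
  rfl

/-- The first `n` coordinates of a realization. -/
def truncate (n : ℕ) (x : Omega) : Fin n → Bool := fun i => x i

theorem measurable_truncate (n : ℕ) : Measurable (truncate n) := by
  unfold truncate
  fun_prop

theorem cyl_ofFn_eq_preimage {m : ℕ} (s : Fin m → Bool) :
    cyl (List.ofFn s) = truncate m ⁻¹' {s} := by
  rw [cyl_ofFn]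
  ext x
  simp [truncate, funext_iff]

theorem map_truncate_apply_singleton (μ : Measure Omega) {m : ℕ} (s : Fin m → Bool) :
    μ.map (truncate m) {s} = μ (cyl (List.ofFn s)) := by
  rw [Measure.map_apply (measurable_truncate m) (measurableSet_singleton s), cyl_ofFn_eq_preimage]

theorem measurableSet_cyl (σ : List Bool) : MeasurableSet (cyl σ) := by
  rw [← List.ofFn_get σ, cyl_ofFn_eq_preimage]
  exact measurable_truncate _ (measurableSet_singleton _)

/-- Finite measures on `Omega` are determined by the mass of cylinders. -/
theorem ext_of_cyl {μ ν : Measure Omega} [IsFiniteMeasure μ]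
    (h : ∀ σ, μ (cyl σ) = ν (cyl σ)) : μ = ν := by
  have hmap (n : ℕ) : μ.map (truncate n) = ν.map (truncate n) :=
    Measure.ext_of_singleton fun s => by
      simp only [map_truncate_apply_singleton, h]
  have hpre (n : ℕ) (S : Set (Fin n → Bool)) :
      μ (truncate n ⁻¹' S) = ν (truncate n ⁻¹' S) := by
    rw [← Measure.map_apply (measurable_truncate n) S.toFinite.measurableSet, hmap,
      Measure.map_apply (measurable_truncate n) S.toFinite.measurableSet]
  refine ext_of_generate_finite _ generateFrom_measurableCylinders.symm
    isPiSystem_measurableCylinders (fun t ht => ?_) (hpre 0 Set.univ)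
  obtain ⟨I, S, -, rfl⟩ := (mem_measurableCylinders t).1 ht
  have hI (i : I) : (i : ℕ) < I.sup id + 1 := Nat.lt_succ_of_le (Finset.le_sup (f := id) i.2)
  exact hpre (I.sup id + 1) {τ | (fun i : I => τ ⟨i, hI i⟩) ∈ S}

theorem Exchangeable.map_truncate_comp_perm {μ : Measure Omega} (hμ : Exchangeable μ) {n : ℕ}
    (π : Equiv.Perm (Fin n)) :
    (μ.map (truncate n)).map (fun τ => τ ∘ π) = μ.map (truncate n) := by
  refine Measure.ext_of_singleton fun s => ?_
  have hs : (fun τ : Fin n → Bool => τ ∘ π) ⁻¹' {s} = {s ∘ π.symm} := by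
    ext τ
    simp only [Set.mem_preimage, Set.mem_singleton_iff]
    exact (Equiv.eq_comp_symm π τ s).symm
  rw [Measure.map_apply (measurable_of_finite _) (measurableSet_singleton s), hs,
    map_truncate_apply_singleton, map_truncate_apply_singleton]
  have key := hμ (List.ofFn s) ((finCongr (by simp)).permCongr π.symm)
  rw [key]
  congr 2
  refine List.ext_get (by simp) fun i h₁ h₂ => ?_
  simp [Equiv.permCongr_apply]

/-- Under an exchangeable measure, any distinct coordinates have the law of the initial ones. -/
theorem Exchangeable.measure_setOf_comp_embedding {μ : Measure Omega} (hμ : Exchangeable μ)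
    {m n : ℕ} (f : Fin m ↪ Fin n) (s : Fin m → Bool) :
    μ {x | ∀ i, x (f i) = s i} = μ (cyl (List.ofFn s)) := by
  have hmn : m ≤ n := by simpa using Fintype.card_le_of_embedding f
  obtain ⟨π, hπ⟩ := Equiv.Perm.exists_extending_pair (Fin.castLE hmn) f
    (Fin.castLE_injective hmn) f.injective
  have h₁ : {x : Omega | ∀ i, x (f i) = s i} =
      truncate n ⁻¹' ((fun τ => τ ∘ π) ⁻¹' {τ | ∀ i, τ (Fin.castLE hmn i) = s i}) := by
    ext x
    simp [truncate, hπ]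
  rw [h₁, ← Measure.map_apply (measurable_truncate n) (Set.toFinite _).measurableSet,
    ← Measure.map_apply (measurable_of_finite _) (Set.toFinite _).measurableSet,
    hμ.map_truncate_comp_perm, Measure.map_apply (measurable_truncate n)
      (Set.toFinite _).measurableSet, cyl_ofFn]
  rfl
theorem continuous_bern (σ : List Bool) : Continuous (bern σ) := by
  unfold bern
  refine continuous_finsetProd _ fun i _ => ?_
  split_ifs <;> fun_prop

theorem bern_nonneg (σ : List Bool) (q : unitInterval) : 0 ≤ bern σ q :=
  Finset.prod_nonneg fun i _ => by
    split_ifs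
    exacts [q.2.1, sub_nonneg.2 q.2.2]

/-- The proportion of successes among the first `n` coordinates. -/
noncomputable def empiricalMean (n : ℕ) (x : Omega) : unitInterval :=
  ⟨(∑ i ∈ Finset.range n, (if x i then (1 : ℝ) else 0)) / n,
    div_nonneg (Finset.sum_nonneg fun _ _ => by split_ifs <;> norm_num) n.cast_nonneg,
    div_le_one_of_le₀ ((Finset.sum_le_sum (g := fun _ => (1 : ℝ)) fun _ _ => by
      split_ifs <;> norm_num).trans (by simp)) n.cast_nonneg⟩

theorem measurable_empiricalMean (n : ℕ) : Measurable (empiricalMean n) := by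
  refine Measurable.subtype_mk ((Finset.measurable_sum _ fun i _ => ?_).div_const _)
  exact (measurable_of_finite fun b : Bool => if b then (1 : ℝ) else 0).comp (measurable_pi_apply i)

theorem measurable_Lmap : Measurable Lmap :=
  continuous_projIcc.measurable.comp
    (Measurable.limsup fun n => (measurable_empiricalMean n).subtype_val)

theorem Lmap_eq_of_tendsto {x : Omega} {q : unitInterval}
    (h : Tendsto (fun n => (empiricalMean n x : ℝ)) atTop (𝓝 q)) : Lmap x = q := by
  have : limsup (fun n : ℕ => (∑ i ∈ Finset.range n, (if x i then (1 : ℝ) else 0)) / n) atTop = q :=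
    h.limsup_eq
  rw [Lmap, this, Set.projIcc_val]

/-- The law of an i.i.d. sequence of uniform random variables. -/
noncomputable def uniformSeq : Measure (ℕ → unitInterval) :=
  Measure.infinitePi fun _ => volume

instance : IsProbabilityMeasure uniformSeq := by
  unfold uniformSeq
  infer_instance

theorem measurePreserving_eval_uniformSeq (i : ℕ) :
    MeasurePreserving (fun u : ℕ → unitInterval => u i) uniformSeq volume :=
  measurePreserving_eval_infinitePi _ i

/-- The realization obtained by comparing a sequence of levels with a threshold. -/
noncomputable def threshold (p : unitInterval × (ℕ → unitInterval)) : Omega := fun i => decide (p.2 i < p.1)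

theorem measurable_threshold : Measurable threshold := by
  refine measurable_pi_lambda _ fun i => measurable_to_bool ?_
  have : (fun p => threshold p i) ⁻¹' {true} =
      {p | p.2 i < p.1} := by
    ext p
    simp [threshold]
  rw [this]
  exact measurableSet_lt (by fun_prop) (by fun_prop)

theorem uniformSeq_threshold_cyl (q : unitInterval) (σ : List Bool) :
    uniformSeq {u | threshold (q, u) ∈ cyl σ} = ENNReal.ofReal (bern σ q) := by
  have hset : {u | threshold (q, u) ∈ cyl σ} = Set.pi (Finset.range σ.length)
      fun i => if σ.getD i false then Set.Iio q else Set.Ici q := by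
    ext u
    simp only [cyl, threshold, Set.mem_ofPred_eq, Set.mem_pi, Finset.coe_range, Set.mem_Iio]
    constructor
    · intro h i hi
      have := h ⟨i, hi⟩
      cases hb : σ[i] <;> simp_all
    · intro h i
      have := h i i.2
      cases hb : σ[(i : ℕ)] <;> simp_all
  rw [hset, uniformSeq, Measure.infinitePi_pi, bern,
    ENNReal.ofReal_prod_of_nonneg, Finset.prod_range]
  · refine Finset.prod_congr rfl fun i _ => ?_
    cases hb : σ[(i : ℕ)] <;> simp [hb]
  · intro i _
    split_ifs
    exacts [q.2.1, sub_nonneg.2 q.2.2]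
  · intro i _
    split_ifs
    exacts [measurableSet_Iio, measurableSet_Ici]

/-- The mixture of Bernoulli sequences with mixing measure `lam`. -/
noncomputable def bernoulliMixture (lam : ProbabilityMeasure unitInterval) :
    ProbabilityMeasure Omega :=
  ⟨((lam : Measure unitInterval).prod uniformSeq).map threshold,
    Measure.isProbabilityMeasure_map measurable_threshold.aemeasurable⟩

theorem bernoulliMixture_cyl (lam : ProbabilityMeasure unitInterval) (σ : List Bool) :
    (bernoulliMixture lam : Measure Omega) (cyl σ) =
      ENNReal.ofReal (∫ q, bern σ q ∂(lam : Measure unitInterval)) := by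
  have hσ := measurableSet_cyl σ
  change (((lam : Measure unitInterval).prod uniformSeq).map threshold) (cyl σ) = _
  rw [Measure.map_apply measurable_threshold hσ, Measure.prod_apply (measurable_threshold hσ),
    ofReal_integral_eq_lintegral_ofReal
      ((continuous_bern σ).integrable_of_hasCompactSupport (HasCompactSupport.of_compactSpace _))
      (ae_of_all _ (bern_nonneg σ))]
  exact lintegral_congr fun q => uniformSeq_threshold_cyl q σ

theorem exchangeable_bernoulliMixture (lam : ProbabilityMeasure unitInterval) :
    Exchangeable (bernoulliMixture lam : Measure Omega) := by
  intro σ π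
  have (q : unitInterval) : bern (List.ofFn fun i => σ.get (π i)) q = bern σ q := by
    rw [bern_ofFn, bern]
    exact Equiv.prod_comp π fun i => if σ.get i then (q : ℝ) else 1 - (q : ℝ)
  simp only [bernoulliMixture_cyl, this]

open ProbabilityTheory in
/-- The strong law of large numbers for Bernoulli sequences. -/
theorem ae_Lmap_threshold (q : unitInterval) : ∀ᵐ u ∂uniformSeq, Lmap (threshold (q, u)) = q := by
  set g : unitInterval → ℝ := (Set.Iio q).indicator 1 with hg_def
  have hg : Measurable g := measurable_one.indicator measurableSet_Iio
  have hindep : iIndepFun (fun (i : ℕ) (u : ℕ → unitInterval) => g (u i)) uniformSeq :=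
    iIndepFun_infinitePi fun _ => hg
  have hident (i : ℕ) : IdentDistrib (fun u : ℕ → unitInterval => g (u i)) (fun u => g (u 0))
      uniformSeq uniformSeq :=
    have hi := measurePreserving_eval_uniformSeq i
    have h₀ := measurePreserving_eval_uniformSeq 0
    IdentDistrib.comp ⟨hi.aemeasurable, h₀.aemeasurable, hi.map_eq.trans h₀.map_eq.symm⟩ hg
  have hint : Integrable (fun u : ℕ → unitInterval => g (u 0)) uniformSeq :=
    (measurePreserving_eval_uniformSeq 0).integrable_comp_of_integrable
      ((integrable_const (1 : ℝ)).indicator measurableSet_Iio)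
  have hmean : ∫ u, g (u 0) ∂uniformSeq = q := by
    have hmp := measurePreserving_eval_uniformSeq 0
    rw [← integral_map (φ := fun u : ℕ → unitInterval => u 0) (f := g) hmp.aemeasurable
      hg.aestronglyMeasurable, hmp.map_eq, hg_def, integral_indicator_one measurableSet_Iio,
      measureReal_def, unitInterval.volume_Iio, ENNReal.toReal_ofReal q.2.1]
  have hslln := strong_law_ae_real (fun (i : ℕ) (u : ℕ → unitInterval) => g (u i)) hint
    (fun i j hij => hindep.indepFun hij) hident
  filter_upwards [hslln] with u hu
  rw [hmean] at hu
  refine Lmap_eq_of_tendsto (hu.congr fun n => ?_)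
  simp [empiricalMean, threshold, hg_def, Set.indicator_apply]

theorem map_Lmap_bernoulliMixture (lam : ProbabilityMeasure unitInterval) :
    (bernoulliMixture lam : Measure Omega).map Lmap = lam := by
  change (((lam : Measure unitInterval).prod uniformSeq).map threshold).map Lmap = _
  have hL := measurable_Lmap.comp measurable_threshold
  rw [Measure.map_map measurable_Lmap measurable_threshold]
  have hae : Lmap ∘ threshold =ᵐ[(lam : Measure unitInterval).prod uniformSeq] Prod.fst := by
    refine (Measure.ae_prod_iff_ae_ae (measurableSet_eq_fun hL measurable_fst)).2 ?_
    exact ae_of_all _ ae_Lmap_threshold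
  rw [Measure.map_congr hae]
  exact measurePreserving_fst.map_eq

theorem continuousAt_threshold {q : unitInterval} {u : ℕ → unitInterval} (h : ∀ i, u i ≠ q) :
    ContinuousAt (fun q => threshold (q, u)) q := by
  refine continuousAt_pi.2 fun i => ?_
  refine (continuousAt_const (y := decide (u i < q))).congr ?_
  rcases (h i).lt_or_gt with hi | hi
  · filter_upwards [lt_mem_nhds hi] with r hr
    simp [threshold, hi, hr]
  · filter_upwards [gt_mem_nhds hi] with r hr
    simp [threshold, hi.not_gt, hr.not_gt]

open BoundedContinuousFunction in
theorem continuous_integral_threshold (f : Omega →ᵇ ℝ) :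
    Continuous fun q => ∫ u, f (threshold (q, u)) ∂uniformSeq := by
  refine continuous_iff_continuousAt.2 fun q => ?_
  refine continuousAt_of_dominated (bound := fun _ => ‖f‖) (Eventually.of_forall fun r => ?_)
    (Eventually.of_forall fun r => ae_of_all _ fun u => f.norm_coe_le_norm _)
    (integrable_const _) ?_
  · exact (f.continuous.measurable.comp
      (measurable_threshold.comp measurable_prodMk_left)).aestronglyMeasurable
  · have hne (i : ℕ) : ∀ᵐ u ∂uniformSeq, u i ≠ q :=
      (measurePreserving_eval_uniformSeq i).quasiMeasurePreserving.ae (Measure.ae_ne volume q)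
    filter_upwards [ae_all_iff.2 hne] with u hu
    exact f.continuous.continuousAt.comp (continuousAt_threshold hu)

open BoundedContinuousFunction in
theorem continuous_bernoulliMixture : Continuous bernoulliMixture := by
  refine continuous_iff_continuousAt.2 fun lam => ?_
  refine ProbabilityMeasure.tendsto_iff_forall_integral_tendsto.2 fun f => ?_
  have hint (κ : ProbabilityMeasure unitInterval) : ∫ x, f x ∂(bernoulliMixture κ : Measure Omega) =
      ∫ q, ∫ u, f (threshold (q, u)) ∂uniformSeq ∂(κ : Measure unitInterval) := by
    change ∫ x, f x ∂(((κ : Measure unitInterval).prod uniformSeq).map threshold) = _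
    have hf := f.continuous.measurable
    rw [integral_map measurable_threshold.aemeasurable hf.aestronglyMeasurable]
    exact integral_prod _ (.of_bound (hf.comp measurable_threshold).aestronglyMeasurable ‖f‖
      (ae_of_all _ fun p => f.norm_coe_le_norm _))
  simp only [hint]
  exact ProbabilityMeasure.tendsto_iff_forall_integral_tendsto.1 tendsto_id
    (mkOfCompact ⟨_, continuous_integral_threshold f⟩)

theorem bern_empiricalMean {m n : ℕ} (s : Fin m → Bool) (x : Omega) (hn : 0 < n) :
    bern (List.ofFn s) (empiricalMean n x) =
      (∑ f : Fin m → Fin n, {x : Omega | ∀ i, x (f i) = s i}.indicator 1 x) / (n : ℝ) ^ m := by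
  have hn' : (n : ℝ) ≠ 0 := by positivity
  have hfactor (b : Bool) : (if b then (empiricalMean n x : ℝ) else 1 - (empiricalMean n x : ℝ)) =
      (∑ j : Fin n, if x j = b then (1 : ℝ) else 0) / n := by
    have hmean : (empiricalMean n x : ℝ) = (∑ j : Fin n, if x j then (1 : ℝ) else 0) / n := by
      simp only [empiricalMean, Finset.sum_range]
    cases b with
    | true => simp [hmean]
    | false =>
      rw [hmean, if_neg Bool.false_ne_true, eq_div_iff hn', sub_mul, div_mul_cancel₀ _ hn', one_mul,
        sub_eq_iff_eq_add, ← Finset.sum_add_distrib]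
      trans ∑ j : Fin n, (1 : ℝ)
      · simp
      · refine Finset.sum_congr rfl fun j _ => ?_
        cases x j <;> simp
  rw [bern_ofFn]
  simp only [hfactor]
  rw [Finset.prod_div_distrib, Finset.prod_const, Finset.card_univ, Fintype.card_fin,
    Finset.prod_univ_sum, Fintype.piFinset_univ]
  congr 1
  refine Finset.sum_congr rfl fun f _ => ?_
  by_cases h : ∀ i, x (f i) = s i
  · simp [h]
  · rw [Set.indicator_of_notMem (by simpa using h)]
    push Not at h
    obtain ⟨i, hi⟩ := h
    exact Finset.prod_eq_zero (Finset.mem_univ i) (if_neg hi)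

theorem Exchangeable.abs_integral_bern_empiricalMean_sub_le {μ : Measure Omega}
    [IsProbabilityMeasure μ] (hμ : Exchangeable μ) {m n : ℕ} (s : Fin m → Bool) (hn : 0 < n) :
    |∫ x, bern (List.ofFn s) (empiricalMean n x) ∂μ - μ.real (cyl (List.ofFn s))| ≤
      1 - (n.descFactorial m : ℝ) / (n : ℝ) ^ m := by
  classical
  have hpow : (0 : ℝ) < (n : ℝ) ^ m := by positivity
  have hmeas (f : Fin m → Fin n) : MeasurableSet {x : Omega | ∀ i, x (f i) = s i} := by
    rw [Set.ofPred_forall]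
    exact MeasurableSet.iInter fun i => 
      measurableSet_eq_fun (measurable_pi_apply _) measurable_const
  have hint : ∫ x, bern (List.ofFn s) (empiricalMean n x) ∂μ =
      (∑ f : Fin m → Fin n, μ.real {x | ∀ i, x (f i) = s i}) / (n : ℝ) ^ m := by
    simp only [bern_empiricalMean s _ hn]
    rw [integral_div, integral_finsetSum _ fun f _ => ?_]
    · simp only [integral_indicator_one (hmeas _)]
    · exact (integrable_const (1 : ℝ)).indicator (hmeas f)
  have hcard : (Finset.univ.filter fun f : Fin m → Fin n => Function.Injective f).card =
      n.descFactorial m := by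
    rw [← Fintype.card_subtype, Fintype.card_congr (Equiv.subtypeInjectiveEquivEmbedding _ _),
      Fintype.card_embedding_eq, Fintype.card_fin, Fintype.card_fin]
  have hsum (c : ℝ) : c = (∑ _f : Fin m → Fin n, c) / (n : ℝ) ^ m := by
    rw [Finset.sum_const, Finset.card_univ, Fintype.card_fun, Fintype.card_fin, Fintype.card_fin,
      nsmul_eq_mul, Nat.cast_pow, mul_div_cancel_left₀ _ hpow.ne']
  have hterm (f : Fin m → Fin n) :
      |μ.real {x | ∀ i, x (f i) = s i} - μ.real (cyl (List.ofFn s))| ≤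
        1 - if Function.Injective f then 1 else 0 := by
    split_ifs with hf
    · rw [measureReal_def, measureReal_def, ← hμ.measure_setOf_comp_embedding ⟨f, hf⟩ s]
      simp
    · rw [sub_zero]
      exact abs_sub_le_of_le_of_le measureReal_nonneg measureReal_le_one measureReal_nonneg
        measureReal_le_one |>.trans (by norm_num)
  rw [hint, hsum (μ.real (cyl (List.ofFn s))), ← sub_div, ← Finset.sum_sub_distrib, abs_div,
    abs_of_pos hpow, ← hcard]
  refine le_of_le_of_eq ?_ (congrArg (· - _) (hsum 1).symm)
  rw [← sub_div]
  gcongr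
  refine (Finset.abs_sum_le_sum_abs _ _).trans ((Finset.sum_le_sum fun f _ => hterm f).trans_eq ?_)
  rw [Finset.sum_sub_distrib, Finset.sum_boole]

theorem Exchangeable.tendsto_integral_bern_empiricalMean {μ : Measure Omega}
    [IsProbabilityMeasure μ] (hμ : Exchangeable μ) (σ : List Bool) :
    Tendsto (fun n => ∫ x, bern σ (empiricalMean n x) ∂μ) atTop (𝓝 (μ.real (cyl σ))) := by
  obtain ⟨m, s, rfl⟩ : ∃ (m : ℕ) (s : Fin m → Bool), σ = List.ofFn s :=
    ⟨_, _, (List.ofFn_get σ).symm⟩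
  rw [tendsto_iff_dist_tendsto_zero]
  have hlim : Tendsto (fun n : ℕ => 1 - (n.descFactorial m : ℝ) / (n : ℝ) ^ m) atTop (𝓝 0) := by
    have h := (Asymptotics.isEquivalent_iff_tendsto_one ?_).1 (isEquivalent_descFactorial m)
    · simpa using h.const_sub 1
    · filter_upwards [eventually_gt_atTop 0] with n hn
      positivity
  refine squeeze_zero' (Eventually.of_forall fun _ => dist_nonneg) ?_ hlim
  filter_upwards [eventually_gt_atTop 0] with n hn
  exact hμ.abs_integral_bern_empiricalMean_sub_le s hn

/-- De Finetti's theorem: every exchangeable measure is a mixture of Bernoulli sequences. -/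
theorem Exchangeable.exists_bernoulliMixture_eq {μ : ProbabilityMeasure Omega}
    (hμ : Exchangeable (μ : Measure Omega)) : ∃ lam, bernoulliMixture lam = μ := by
  obtain ⟨lam, φ, hφ, hlam⟩ := CompactSpace.tendsto_subseq
    fun n => μ.map (measurable_empiricalMean n).aemeasurable
  refine ⟨lam, ProbabilityMeasure.toMeasure_injective (ext_of_cyl fun σ => ?_)⟩
  have h₁ := ProbabilityMeasure.tendsto_iff_forall_integral_tendsto.1 hlam
    (BoundedContinuousFunction.mkOfCompact ⟨bern σ, continuous_bern σ⟩)
  have h₂ := (hμ.tendsto_integral_bern_empiricalMean σ).comp hφ.tendsto_atTop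
  have h₃ : ∫ q, bern σ q ∂(lam : Measure unitInterval) = (μ : Measure Omega).real (cyl σ) := by
    refine tendsto_nhds_unique h₁ (h₂.congr fun n => ?_)
    exact (integral_map (measurable_empiricalMean _).aemeasurable
      (continuous_bern σ).aestronglyMeasurable).symm
  rw [bernoulliMixture_cyl, h₃, ofReal_measureReal]

/-- The bijection between mixing measures and exchangeable measures. -/
noncomputable def bernoulliMixtureEquiv : ProbabilityMeasure unitInterval ≃
    {μ : ProbabilityMeasure Omega // Exchangeable (μ : Measure Omega)} where
  toFun lam := ⟨bernoulliMixture lam, exchangeable_bernoulliMixture lam⟩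
  invFun μ := μ.1.map measurable_Lmap.aemeasurable
  left_inv lam := Subtype.ext (map_Lmap_bernoulliMixture lam)
  right_inv := by
    rintro ⟨μ, hμ⟩
    obtain ⟨lam, rfl⟩ := hμ.exists_bernoulliMixture_eq
    exact Subtype.ext (congrArg bernoulliMixture (Subtype.ext (map_Lmap_bernoulliMixture lam)))

/-- De Finetti's theorem, topological form: λ ↦ ε_λ is a homeomorphism from Δ([0,1])
(weak-* topology) onto the set Γ of exchangeable theories on {0,1}^ℕ, with inverse
μ ↦ μ̄, the pushforward of μ under the limit-average map L. -/
theorem deFinetti_homeomorphism :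
    ∃ e : ProbabilityMeasure unitInterval ≃ₜ
        {μ : ProbabilityMeasure Omega // Exchangeable (μ : Measure Omega)},
      (∀ lam : ProbabilityMeasure unitInterval, ∀ σ : List Bool,
        ((e lam).1 : Measure Omega) (cyl σ) =
          ENNReal.ofReal (∫ q, bern σ q ∂(lam : Measure unitInterval))) ∧
      (∀ μ : {μ : ProbabilityMeasure Omega // Exchangeable (μ : Measure Omega)},
        ((e.symm μ : ProbabilityMeasure unitInterval) : Measure unitInterval) =
          Measure.map Lmap (μ.1 : Measure Omega)) := by
  refine ⟨(continuous_bernoulliMixture.subtype_mk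
    exchangeable_bernoulliMixture).homeoOfEquivCompactToT2 (f := bernoulliMixtureEquiv),
    bernoulliMixture_cyl, fun _ => rfl⟩
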